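/- arXiv:1804.06011 — 3 statements merged into one kernel-verified Lean document; each statement's English description precedes it below -/
import Mathlib

section
/- Let f(x) = x + sin x and suppose α₀ ∈ (1, π/2) satisfies f(f(α₀ − sin α₀)) = sin α₀ (numerically α₀ ≈ 1.14193). Then, in the priority evacuation model with 1 servant, there exist trajectories Q, S₁ that evacuate the queen in time 1 + π − α₀ + 2·sin α₀ (≈ 4.81854). -/
open Real Set MeasureTheory
open scoped RealInnerProductSpace

noncomputable section

abbrev Plane : Type := EuclideanSpace ℝ (Fin 2)

/-- The point of the unit circle at angle `θ`. -/
def circlePt (θ : ℝ) : Plane := (WithLp.equiv 2 (Fin 2 → ℝ)).symm ![Real.cos θ, Real.sin θ]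

/-- A trajectory in the priority evacuation model: a `1`-Lipschitz function on `[0, ∞)`
starting at the origin. -/
def IsTraj (f : ℝ → Plane) : Prop :=
  LipschitzOnWith 1 f (Set.Ici 0) ∧ f 0 = 0

/-- The first-visit time of the point `p` by the queen `Q` or one of the servants `S i`. -/
def visitTime {n : ℕ} (Q : ℝ → Plane) (S : Fin n → ℝ → Plane) (p : Plane) : ℝ :=
  sInf {t : ℝ | 0 ≤ t ∧ (Q t = p ∨ ∃ i, S i t = p)}

/-- The trajectories `Q` (queen) and `S 0, …, S (n-1)` (servants) evacuate the queen in
time `B`: every point of the unit circle is visited, and the first-visit time plus the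
distance from the queen (at that moment) to the point is at most `B`. -/
def Evacuates {n : ℕ} (Q : ℝ → Plane) (S : Fin n → ℝ → Plane) (B : ℝ) : Prop :=
  ∀ p : Plane, ‖p‖ = 1 →
    (∃ t : ℝ, 0 ≤ t ∧ (Q t = p ∨ ∃ i, S i t = p)) ∧
    visitTime Q S p + ‖Q (visitTime Q S p) - p‖ ≤ B

/-- The set of angles in `[0, 2π)` whose circle point is visited by the queen at some
time in `Tset`; its Lebesgue measure is the arc measure of the queen-explored set. -/
def queenArc (Q : ℝ → Plane) (Tset : Set ℝ) : Set ℝ :=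
  {θ : ℝ | θ ∈ Set.Ico 0 (2 * π) ∧ ∃ s ∈ Tset, Q s = circlePt θ}

/-- The function equal to `f` up to time `T` and to `g` afterwards. -/
def glue (T : ℝ) (f g : ℝ → Plane) (t : ℝ) : Plane := if t ≤ T then f t else g t

lemma glue_of_le {T t : ℝ} {f g : ℝ → Plane} (h : t ≤ T) : glue T f g t = f t := if_pos h

lemma glue_of_ge {T t : ℝ} {f g : ℝ → Plane} (hT : f T = g T) (h : T ≤ t) :
    glue T f g t = g t := by
  rcases h.eq_or_lt with rfl | h
  · rw [glue_of_le le_rfl, hT]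
  · exact if_neg h.not_ge

lemma lipschitzWith_glue {T : ℝ} {f g : ℝ → Plane} (hf : LipschitzWith 1 f)
    (hg : LipschitzWith 1 g) (hT : f T = g T) : LipschitzWith 1 (glue T f g) := by
  have key : ∀ s t : ℝ, s ≤ t → dist (glue T f g s) (glue T f g t) ≤ dist s t := by
    intro s t hst
    rcases le_total t T with ht | ht
    · rw [glue_of_le ht, glue_of_le (hst.trans ht)]
      simpa using hf.dist_le_mul s t
    rcases le_total T s with hs | hs
    · rw [glue_of_ge hT ht, glue_of_ge hT hs]
      simpa using hg.dist_le_mul s t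
    · rw [glue_of_ge hT ht, glue_of_le hs]
      have h₁ : dist (f s) (f T) ≤ dist s T := by simpa using hf.dist_le_mul s T
      have h₂ : dist (g T) (g t) ≤ dist T t := by simpa using hg.dist_le_mul T t
      rw [Real.dist_eq, abs_of_nonpos (by linarith)] at h₁ h₂ ⊢
      have := dist_triangle (f s) (f T) (g t)
      rw [hT] at this h₁
      linarith
  refine LipschitzWith.of_dist_le_mul fun s t => ?_
  rw [NNReal.coe_one, one_mul]
  rcases le_total s t with h | h
  · exact key s t h
  · rw [dist_comm, dist_comm s]
    exact key t s h

lemma norm_circlePt_sub (a b : ℝ) :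
    ‖circlePt a - circlePt b‖ = 2 * |Real.sin ((a - b) / 2)| := by
  have h : Real.cos (a - b) = 1 - 2 * Real.sin ((a - b) / 2) ^ 2 := by
    have h₁ := Real.cos_sq ((a - b) / 2)
    have h₂ := Real.sin_sq_add_cos_sq ((a - b) / 2)
    rw [mul_div_cancel₀ _ (two_ne_zero' ℝ)] at h₁
    linarith
  rw [Real.cos_sub] at h
  rw [EuclideanSpace.norm_eq, Real.sqrt_eq_iff_mul_self_eq (by positivity) (by positivity)]
  have h₃ := abs_mul_abs_self (Real.sin ((a - b) / 2))
  simp only [circlePt, Fin.sum_univ_two, Real.norm_eq_abs, sq_abs, PiLp.sub_apply,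
    WithLp.equiv_symm_apply, Matrix.cons_val_zero, Matrix.cons_val_one]
  nlinarith [Real.sin_sq_add_cos_sq a, Real.sin_sq_add_cos_sq b]

lemma norm_circlePt (a : ℝ) : ‖circlePt a‖ = 1 := by
  simp [circlePt, EuclideanSpace.norm_eq, Fin.sum_univ_two]

lemma lipschitzWith_circlePt : LipschitzWith 1 circlePt := by
  refine LipschitzWith.of_dist_le_mul fun a b => ?_
  rw [dist_eq_norm, norm_circlePt_sub, Real.dist_eq, NNReal.coe_one, one_mul]
  have := Real.abs_sin_le_abs (x := (a - b) / 2)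
  rw [abs_div, abs_two] at this
  linarith

lemma circlePt_add_two_pi (a : ℝ) : circlePt (a + 2 * π) = circlePt a := by
  simp [circlePt]

lemma exists_eq_circlePt {p : Plane} (hp : ‖p‖ = 1) :
    ∃ θ : ℝ, 0 ≤ θ ∧ θ ≤ 2 * π ∧ p = circlePt θ := by
  have h : ∃ θ : ℝ, -π < θ ∧ θ ≤ π ∧ p = circlePt θ := by
    have hw : ‖(⟨p 0, p 1⟩ : ℂ)‖ = 1 := by
      rw [← hp, EuclideanSpace.norm_eq, Complex.norm_eq_sqrt_sq_add_sq]
      simp [Fin.sum_univ_two]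
    refine ⟨Complex.arg ⟨p 0, p 1⟩, Complex.neg_pi_lt_arg _, Complex.arg_le_pi _, ?_⟩
    have hc := Complex.norm_mul_cos_arg ⟨p 0, p 1⟩
    have hs := Complex.norm_mul_sin_arg ⟨p 0, p 1⟩
    rw [hw, one_mul] at hc hs
    ext i
    fin_cases i <;> simp [circlePt, hc, hs]
  obtain ⟨θ, h₁, h₂, h₃⟩ := h
  rcases le_total 0 θ with h₀ | h₀
  · exact ⟨θ, h₀, by linarith, h₃⟩
  · exact ⟨θ + 2 * π, by linarith, by linarith, by rw [circlePt_add_two_pi, h₃]⟩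

/-- It suffices to bound the evacuation cost at some visit of each point, since
`t + ‖Q t - p‖` is nondecreasing in `t`. -/
lemma evacuates_of_visits {n : ℕ} {Q : ℝ → Plane} {S : Fin n → ℝ → Plane} {B : ℝ}
    (hQ : LipschitzWith 1 Q)
    (h : ∀ p : Plane, ‖p‖ = 1 → ∃ t : ℝ, 0 ≤ t ∧ (Q t = p ∨ ∃ i, S i t = p) ∧
      t + ‖Q t - p‖ ≤ B) : Evacuates Q S B := by
  intro p hp
  obtain ⟨t, ht, hv, hB⟩ := h p hp
  refine ⟨⟨t, ht, hv⟩, ?_⟩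
  have hle : visitTime Q S p ≤ t := csInf_le ⟨0, fun s hs => hs.1⟩ ⟨ht, hv⟩
  have h₁ := hQ.dist_le_mul (visitTime Q S p) t
  rw [NNReal.coe_one, one_mul, Real.dist_eq, abs_of_nonpos (by linarith)] at h₁
  have h₂ := dist_triangle (Q (visitTime Q S p)) (Q t) p
  rw [dist_eq_norm _ p, dist_eq_norm (Q t) p] at h₂
  linarith

lemma le_of_hasDerivAt_le {f g f' g' : ℝ → ℝ} {a b : ℝ} (hab : a ≤ b)
    (hf : ∀ t, HasDerivAt f (f' t) t) (hg : ∀ t, HasDerivAt g (g' t) t) (ha : f a ≤ g a)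
    (h : ∀ t, a ≤ t → t ≤ b → f' t ≤ g' t) : f b ≤ g b :=
  image_le_of_deriv_right_le_deriv_boundary
    (fun t _ => (hf t).continuousAt.continuousWithinAt) (fun t _ => (hf t).hasDerivWithinAt) ha
    (fun t _ => (hg t).continuousAt.continuousWithinAt) (fun t _ => (hg t).hasDerivWithinAt)
    (fun t ht => h t ht.1 ht.2.le) ⟨hab, le_rfl⟩

lemma cos_le_quartic {t : ℝ} (ht : 0 ≤ t) :
    Real.cos t ≤ 1 - t ^ 2 / 2 + t ^ 4 / 24 := by
  refine le_of_hasDerivAt_le (f := Real.cos) (f' := fun t => -Real.sin t)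
    (g := fun t => 1 - t ^ 2 / 2 + t ^ 4 / 24) (g' := fun t => -(t - t ^ 3 / 6)) ht
    Real.hasDerivAt_cos (fun t => ?_) (by simp) fun t ht _ => neg_le_neg (Real.sin_ge_sub_cube ht)
  refine ((((hasDerivAt_pow 2 t).div_const 2).const_sub 1).add
    ((hasDerivAt_pow 4 t).div_const 24)).congr_deriv ?_
  push_cast
  ring

lemma sin_le_quintic {t : ℝ} (ht : 0 ≤ t) :
    Real.sin t ≤ t - t ^ 3 / 6 + t ^ 5 / 120 := by
  refine le_of_hasDerivAt_le (f := Real.sin) (f' := Real.cos)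
    (g := fun t => t - t ^ 3 / 6 + t ^ 5 / 120) (g' := fun t => 1 - t ^ 2 / 2 + t ^ 4 / 24) ht
    Real.hasDerivAt_sin (fun t => ?_) (by simp) fun t ht _ => cos_le_quartic ht
  refine (((hasDerivAt_id t).sub ((hasDerivAt_pow 3 t).div_const 6)).add
    ((hasDerivAt_pow 5 t).div_const 120)).congr_deriv ?_
  push_cast
  ring

lemma sin_sub_le {a s : ℝ} (hs : 0 ≤ s) (hsa : s ≤ a) (ha : a ≤ π) :
    Real.sin (a - s) ≤ Real.sin a - s * Real.cos a := by
  refine le_of_hasDerivAt_le (f := fun s => Real.sin (a - s))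
    (f' := fun s => -Real.cos (a - s)) (g := fun s => Real.sin a - s * Real.cos a)
    (g' := fun _ => -Real.cos a) hs (fun t => ?_) (fun t => ?_) (by simp) fun t ht hts =>
      neg_le_neg (Real.cos_le_cos_of_nonneg_of_le_pi (by linarith) ha (by linarith))
  · simpa using ((hasDerivAt_id t).const_sub a).sin
  · simpa using ((hasDerivAt_id t).mul_const (Real.cos a)).const_sub (Real.sin a)

lemma add_two_mul_sin_le {u x : ℝ} (hu : 0 ≤ u) (hux : u ≤ x) (hx : x ≤ π - π / 3) :
    u + 2 * Real.sin u ≤ x + 2 * Real.sin x := by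
  refine le_of_hasDerivAt_le (f := fun _ => u + 2 * Real.sin u) (f' := fun _ => 0)
    (g := fun t => t + 2 * Real.sin t) (g' := fun t => 1 + 2 * Real.cos t) hux
    (fun t => hasDerivAt_const t _)
    (fun t => (hasDerivAt_id t).add ((Real.hasDerivAt_sin t).const_mul 2)) le_rfl
    fun t ht htx => ?_
  have := Real.cos_le_cos_of_nonneg_of_le_pi (hu.trans ht)
    (by linarith [Real.pi_pos]) (htx.trans hx)
  rw [Real.cos_pi_sub, Real.cos_pi_div_three] at this
  linarith

/-- Bounds on a root `α` of `f (f (α - sin α)) = sin α`, where `f x = x + sin x`. -/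
lemma root_bounds {α y z : ℝ} (hα : α ∈ Set.Ioo 1 (π / 2)) (hy : y = α - Real.sin α)
    (hz : z = y + Real.sin y) (hroot : z + Real.sin z = Real.sin α) :
    0 < y ∧ 0 < z ∧ z < 1 ∧ π / 3 ≤ α ∧
      Real.sin z ≤ Real.sin z * (2 * Real.cos α) + Real.sin α * (1 - Real.cos z) := by
  obtain ⟨h₁, h₂⟩ := hα
  have hpi := Real.pi_lt_d2
  have hy₀ : 0 < y := by linarith [Real.sin_lt (x := α) (by linarith)]
  have hs₁ := Real.sin_le_one α
  have hs₀ : 0 < Real.sin α := Real.sin_pos_of_pos_of_lt_pi (by linarith) (by linarith)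
  have hy₁ : y < 1 := by
    have hc := Real.sin_ge_sub_cube (x := α) (by linarith)
    have : α ^ 3 ≤ 1.575 ^ 3 := by
      have : α ≤ 1.575 := by linarith
      gcongr
    linarith
  have hsy : 0 < Real.sin y := Real.sin_pos_of_pos_of_lt_pi hy₀ (by linarith)
  have hz₀ : 0 < z := by linarith
  have hz₂ : z ≤ 2 := by linarith [Real.sin_le_one y]
  have hsz : 0 < Real.sin z := Real.sin_pos_of_pos_of_lt_pi hz₀ (by linarith [Real.pi_gt_three])
  have hz₁ : z < 1 := by linarith
  have hzc := Real.sin_ge_sub_cube hz₀.le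
  have hyc := Real.sin_ge_sub_cube hy₀.le
  have hz₃ : z ≤ 6 / 11 := by
    have : z ^ 3 ≤ z := by nlinarith [mul_pos hz₀ hz₀]
    linarith
  have hy₃ : y ≤ 0.298 := by
    have : y ^ 3 ≤ y := by nlinarith [mul_pos hy₀ hy₀]
    linarith
  have hz₄ : 0.95 * z ≤ Real.sin z := by
    have : z ^ 2 ≤ (6 / 11) ^ 2 := by gcongr
    nlinarith [mul_le_mul_of_nonneg_right this hz₀.le]
  have hy₄ : 0.985 * y ≤ Real.sin y := by
    have : y ^ 2 ≤ 0.298 ^ 2 := by gcongr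
    nlinarith [mul_le_mul_of_nonneg_right this hy₀.le]
  have hlow : 5 * Real.sin α ≤ 4 * α := by
    linarith [Real.sin_le hz₀.le, Real.sin_le hy₀.le]
  have hup : 3.87 * α ≤ 4.87 * Real.sin α := by linarith
  have hα₁ : π / 3 ≤ α := by
    by_contra! h
    have hc := Real.sin_ge_sub_cube (x := α) (by linarith)
    have : α ^ 2 ≤ 1.05 ^ 2 := by
      have : α ≤ 1.05 := by linarith
      gcongr
    nlinarith [mul_le_mul_of_nonneg_right this (show 0 ≤ α by linarith)]
  have hα₂ : α ≤ 1.155 := by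
    by_contra! h
    have hc := sin_le_quintic (t := α) (by linarith)
    have hq : 3.87 / 4.87 ≤ 1 - α ^ 2 / 6 + (α ^ 2) ^ 2 / 120 := by
      refine le_of_mul_le_mul_right ?_ (show 0 < α by linarith)
      linarith
    have h₃ : 1.155 ^ 2 ≤ α ^ 2 := by gcongr
    have h₄ : α ^ 2 ≤ 2 ^ 2 := by
      have : α ≤ 2 := by linarith
      gcongr
    have h₅ := mul_nonneg (sub_nonneg.2 h₃) (sub_nonneg.2 h₄)
    linarith
  have hsin : Real.sin α ≤ 0.9154 := by
    have h := Real.sin_le_sin_of_le_of_le_pi_div_two (x := α) (y := 1.155)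
      (by linarith) (by linarith [Real.pi_gt_d2]) hα₂
    have := sin_le_quintic (t := 1.155) (by norm_num)
    norm_num at this h ⊢
    linarith
  have hcos : 0.395 ≤ Real.cos α := by
    have h₀ : 0 ≤ Real.cos α := Real.cos_nonneg_of_mem_Icc ⟨by linarith, by linarith⟩
    by_contra! h
    have hc₂ : Real.cos α ^ 2 ≤ 0.395 ^ 2 := by gcongr
    have hs₂ : Real.sin α ^ 2 ≤ 0.9154 ^ 2 := by gcongr
    linarith [Real.sin_sq_add_cos_sq α]
  have htan : Real.sin z * (z / 2) ≤ 1 - Real.cos z := by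
    have hh₀ : 0 < Real.sin (z / 2) :=
      Real.sin_pos_of_pos_of_lt_pi (by linarith) (by linarith [Real.pi_gt_three])
    have hh₁ : 0 < Real.cos (z / 2) :=
      Real.cos_pos_of_mem_Ioo ⟨by linarith, by linarith [Real.pi_gt_three]⟩
    have hs : Real.sin z = 2 * Real.sin (z / 2) * Real.cos (z / 2) := by
      rw [← Real.sin_two_mul]; ring_nf
    have hc : 1 - Real.cos z = 2 * Real.sin (z / 2) ^ 2 := by
      have := Real.cos_sq (z / 2)
      rw [mul_div_cancel₀ _ (two_ne_zero' ℝ)] at this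
      linarith [Real.sin_sq_add_cos_sq (z / 2)]
    have ht := Real.le_tan (x := z / 2) (by linarith) (by linarith [Real.pi_gt_three])
    rw [Real.tan_eq_sin_div_cos, le_div_iff₀ hh₁] at ht
    have := mul_le_mul_of_nonneg_left ht hh₀.le
    rw [hs, hc]
    linarith
  refine ⟨hy₀, hz₀, hz₁, hα₁, ?_⟩
  have hz₅ : Real.sin α / 2 ≤ z := by linarith [Real.sin_le hz₀.le]
  have hmain : 1 ≤ 2 * Real.cos α + Real.sin α * (z / 2) := by
    have := Real.sin_sq_add_cos_sq α
    have h₃ : Real.sin α * (Real.sin α / 2) ≤ Real.sin α * z := by gcongr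
    have h₄ := mul_nonneg (sub_nonneg.2 hcos) (sub_nonneg.2 (Real.cos_le_one α))
    linarith
  linarith [mul_le_mul_of_nonneg_left htan hs₀.le, mul_le_mul_of_nonneg_left hmain hsz.le]

/-- The trigonometric inequality controlling the cost while the queen crosses a chord. -/
lemma chord_cost_le {α z σ : ℝ} (hα₂ : α ≤ π / 2) (hz : 0 < z) (hz₁ : z < 1)
    (hσ : 0 ≤ σ) (hασ : z + σ ≤ α)
    (h : Real.sin z ≤ Real.sin z * (2 * Real.cos α) + Real.sin α * (1 - Real.cos z)) :
    σ + (1 - σ / Real.sin z) * Real.sin (α - σ) + σ / Real.sin z * Real.sin (α - z - σ)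
      ≤ Real.sin α := by
  have hpi := Real.pi_gt_three
  have hsz : 0 < Real.sin z := Real.sin_pos_of_pos_of_lt_pi hz (by linarith)
  have h₁ : Real.sin (α - σ) ≤ Real.sin α - σ * Real.cos α :=
    sin_sub_le hσ (by linarith) (by linarith)
  have h₂ : Real.sin α - Real.sin (α - z) ≤ Real.sin (α - σ) - Real.sin (α - z - σ) := by
    rw [Real.sin_sub_sin, Real.sin_sub_sin]
    have hc : Real.cos ((α + (α - z)) / 2) ≤ Real.cos ((α - σ + (α - z - σ)) / 2) :=
      Real.cos_le_cos_of_nonneg_of_le_pi (by linarith) (by linarith) (by linarith)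
    have hs : 0 ≤ Real.sin ((α - (α - z)) / 2) :=
      Real.sin_nonneg_of_nonneg_of_le_pi (by linarith) (by linarith)
    rw [show (α - σ - (α - z - σ)) / 2 = (α - (α - z)) / 2 by ring]
    gcongr
  have h₃ : Real.sin z * (1 - Real.cos α) ≤ Real.sin α - Real.sin (α - z) := by
    rw [Real.sin_sub]
    linarith
  have h₄ : σ * (1 - Real.cos α) ≤
      σ / Real.sin z * (Real.sin (α - σ) - Real.sin (α - z - σ)) := by
    calc σ * (1 - Real.cos α) = σ / Real.sin z * (Real.sin z * (1 - Real.cos α)) := by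
          field_simp
      _ ≤ _ := by
          have := h₃.trans h₂
          gcongr
  linarith

/-- with one servant and `α₀ ∈ (1, π/2)` satisfying
`f (f (α₀ - sin α₀)) = sin α₀` where `f x = x + sin x`, the queen can be evacuated in
time `1 + π - α₀ + 2 sin α₀`. -/
theorem priority_evacuation_one_servant_upper_bound
    (f : ℝ → ℝ) (hf : ∀ x, f x = x + Real.sin x)
    (α₀ : ℝ) (hα₀ : α₀ ∈ Set.Ioo 1 (π / 2))
    (hroot : f (f (α₀ - Real.sin α₀)) = Real.sin α₀) :
    ∃ Q S₁ : ℝ → Plane, IsTraj Q ∧ IsTraj S₁ ∧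
      Evacuates Q ![S₁] (1 + π - α₀ + 2 * Real.sin α₀) := by
  obtain ⟨y, hy⟩ : ∃ y, y = α₀ - Real.sin α₀ := ⟨_, rfl⟩
  obtain ⟨z, hz⟩ : ∃ z, z = y + Real.sin y := ⟨_, rfl⟩
  have hroot' : z + Real.sin z = Real.sin α₀ := by
    rw [← hroot, hf, hf, ← hy, ← hz]
  obtain ⟨hy₀, hz₀, hz₁, hα₁, hchord⟩ := root_bounds hα₀ hy hz hroot'
  obtain ⟨h₁, h₂⟩ := hα₀
  have hpi := Real.pi_gt_three
  have hsz : 0 < Real.sin z := Real.sin_pos_of_pos_of_lt_pi hz₀ (by linarith)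
  have hy_pi : y ≤ π := by linarith [Real.neg_one_le_sin α₀]
  obtain ⟨x, hx⟩ : ∃ x, x = π - α₀ := ⟨_, rfl⟩
  set chord : ℝ → Plane := fun t => circlePt x +
    ((t - (1 + x)) / (2 * Real.sin z)) • (circlePt (x + 2 * z) - circlePt x) with hchord_def
  set T : ℝ := 1 + x + 2 * Real.sin z with hT
  set back : ℝ → Plane := fun t => circlePt (x + 2 * z - (t - T)) with hback
  set radial : ℝ → Plane := fun t => t • circlePt 0 with hradial
  set Q₃ : ℝ → Plane := glue T chord back with hQ₃
  set Q₂ : ℝ → Plane := glue (1 + x) (fun t => circlePt (t - 1)) Q₃ with hQ₂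
  set Q : ℝ → Plane := glue 1 radial Q₂ with hQ
  set S : ℝ → Plane := glue 1 radial (fun t => circlePt (1 - t)) with hS
  have lip_circle : ∀ a ε : ℝ, |ε| = 1 → LipschitzWith 1 fun t => circlePt (a + ε * t) := by
    intro a ε hε
    refine LipschitzWith.of_dist_le_mul fun s t => ?_
    have := lipschitzWith_circlePt.dist_le_mul (a + ε * s) (a + ε * t)
    rwa [Real.dist_eq, show a + ε * s - (a + ε * t) = ε * (s - t) by ring, abs_mul, hε,
      one_mul, ← Real.dist_eq] at this
  have lip_radial : LipschitzWith 1 radial := by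
    refine LipschitzWith.of_dist_le_mul fun s t => ?_
    rw [hradial, dist_eq_norm, ← sub_smul, norm_smul, norm_circlePt, NNReal.coe_one, one_mul,
      mul_one, Real.dist_eq, Real.norm_eq_abs]
  have lip_chord : LipschitzWith 1 chord := by
    refine LipschitzWith.of_dist_le_mul fun s t => ?_
    rw [hchord_def, dist_eq_norm, add_sub_add_left_eq_sub, ← sub_smul, norm_smul,
      norm_circlePt_sub, show (x + 2 * z - x) / 2 = z by ring, abs_of_pos hsz, ← sub_div,
      norm_div, Real.norm_of_nonneg (show 0 ≤ 2 * Real.sin z by linarith),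
      div_mul_cancel₀ _ (by positivity), NNReal.coe_one, one_mul, Real.dist_eq, Real.norm_eq_abs,
      sub_sub_sub_cancel_right]
  have lip_back : LipschitzWith 1 back := by
    have := lip_circle (x + 2 * z + T) (-1) (by simp)
    convert this using 3
    ring
  have hj₃ : chord T = back T := by
    have : (T - (1 + x)) / (2 * Real.sin z) = 1 := by
      rw [hT, add_sub_cancel_left, div_self (by positivity)]
    simp only [hchord_def, hback, this, one_smul, add_sub_cancel, sub_self, sub_zero]
  have hx₀ : 0 ≤ x := by linarith
  have hj₂ : circlePt (1 + x - 1) = Q₃ (1 + x) := by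
    rw [hQ₃, glue_of_le (by linarith)]
    simp [hchord_def]
  have hj₁ : radial 1 = Q₂ 1 := by
    rw [hQ₂, glue_of_le (by linarith)]
    simp [hradial]
  have hjS : radial 1 = circlePt (1 - 1) := by simp [hradial]
  have lip_Q : LipschitzWith 1 Q := by
    refine lipschitzWith_glue lip_radial (lipschitzWith_glue ?_
      (lipschitzWith_glue lip_chord lip_back hj₃) hj₂) hj₁
    convert lip_circle (-1) 1 (by simp) using 3
    ring
  have lip_S : LipschitzWith 1 S := by
    refine lipschitzWith_glue lip_radial ?_ hjS
    convert lip_circle 1 (-1) (by simp) using 3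
    ring
  have Q_circle : ∀ t, 1 ≤ t → t ≤ 1 + x → Q t = circlePt (t - 1) := fun t h h' => by
    rw [hQ, glue_of_ge hj₁ h, hQ₂, glue_of_le h']
  have Q_chord : ∀ t, 1 + x ≤ t → t ≤ T → Q t = chord t := fun t h h' => by
    rw [hQ, glue_of_ge hj₁ (by linarith), hQ₂, glue_of_ge hj₂ h, hQ₃, glue_of_le h']
  have Q_back : ∀ t, T ≤ t → Q t = back t := fun t h => by
    rw [hQ, glue_of_ge hj₁ (by linarith), hQ₂, glue_of_ge hj₂ (by linarith), hQ₃,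
      glue_of_ge hj₃ h]
  refine ⟨Q, S, ⟨lip_Q.lipschitzOnWith, ?_⟩, ⟨lip_S.lipschitzOnWith, ?_⟩,
    evacuates_of_visits lip_Q fun p hp => ?_⟩
  · rw [hQ, glue_of_le zero_le_one, hradial]; exact zero_smul ℝ _
  · rw [hS, glue_of_le zero_le_one, hradial]; exact zero_smul ℝ _
  obtain ⟨θ, hθ₀, hθ₁, rfl⟩ := exists_eq_circlePt hp
  rcases le_total θ x with hθx | hθx
  · have hv : Q (1 + θ) = circlePt θ := by
      rw [Q_circle _ (by linarith) (by linarith), add_sub_cancel_left]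
    refine ⟨1 + θ, by linarith, Or.inl hv, ?_⟩
    rw [hv, sub_self, norm_zero]
    linarith
  rcases le_total θ (x + 2 * z) with hθz | hθz
  · have hv : Q (T + (x + 2 * z - θ)) = circlePt θ := by
      rw [Q_back _ (by linarith), hback]
      dsimp only
      congr 1
      ring
    refine ⟨T + (x + 2 * z - θ), by linarith, Or.inl hv, ?_⟩
    rw [hv, sub_self, norm_zero]
    linarith
  obtain ⟨u, rfl⟩ : ∃ u, θ = -u + 2 * π := ⟨2 * π - θ, by ring⟩
  rw [circlePt_add_two_pi]
  have hu₀ : 0 ≤ u := by linarith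
  refine ⟨1 + u, by linarith, Or.inr ⟨0, ?_⟩, ?_⟩
  · change S (1 + u) = _
    rw [hS, glue_of_ge hjS (by linarith)]
    congr 1
    ring
  rcases le_total u x with hux | hux
  · rw [Q_circle _ (by linarith) (by linarith), add_sub_cancel_left, norm_circlePt_sub,
      show (u - -u) / 2 = u by ring,
      abs_of_nonneg (Real.sin_nonneg_of_nonneg_of_le_pi hu₀ (by linarith))]
    have hmono := add_two_mul_sin_le hu₀ hux (by linarith)
    have : Real.sin x = Real.sin α₀ := by rw [hx, Real.sin_pi_sub]
    linarith
  rcases le_total (1 + u) T with huT | huT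
  · rw [Q_chord _ (by linarith) huT]
    obtain ⟨σ, rfl⟩ : ∃ σ, u = x + 2 * σ := ⟨(u - x) / 2, by ring⟩
    have hσ : 0 ≤ σ := by linarith
    have hσ₁ : σ ≤ Real.sin z := by linarith
    have hlam : (1 + (x + 2 * σ) - (1 + x)) / (2 * Real.sin z) = σ / Real.sin z := by
      field_simp
      ring
    have hlam₁ : σ / Real.sin z ≤ 1 := (div_le_one hsz).2 hσ₁
    have hsplit : chord (1 + (x + 2 * σ)) - circlePt (-(x + 2 * σ)) =
        (1 - σ / Real.sin z) • (circlePt x - circlePt (-(x + 2 * σ))) +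
          (σ / Real.sin z) • (circlePt (x + 2 * z) - circlePt (-(x + 2 * σ))) := by
      simp only [hchord_def, hlam]
      module
    have hn₁ : ‖circlePt x - circlePt (-(x + 2 * σ))‖ = 2 * Real.sin (α₀ - σ) := by
      rw [norm_circlePt_sub, show (x - -(x + 2 * σ)) / 2 = π - (α₀ - σ) by rw [hx]; ring,
        Real.sin_pi_sub, abs_of_nonneg]
      exact Real.sin_nonneg_of_nonneg_of_le_pi (by linarith) (by linarith)
    have hn₂ : ‖circlePt (x + 2 * z) - circlePt (-(x + 2 * σ))‖ =
        2 * Real.sin (α₀ - z - σ) := by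
      rw [norm_circlePt_sub,
        show (x + 2 * z - -(x + 2 * σ)) / 2 = π - (α₀ - z - σ) by rw [hx]; ring,
        Real.sin_pi_sub, abs_of_nonneg]
      exact Real.sin_nonneg_of_nonneg_of_le_pi (by linarith) (by linarith)
    have htri := norm_add_le
      ((1 - σ / Real.sin z) • (circlePt x - circlePt (-(x + 2 * σ))))
      ((σ / Real.sin z) • (circlePt (x + 2 * z) - circlePt (-(x + 2 * σ))))
    rw [← hsplit, norm_smul, norm_smul, Real.norm_of_nonneg (sub_nonneg.2 hlam₁),
      Real.norm_of_nonneg (by positivity), hn₁, hn₂] at htri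
    have := chord_cost_le h₂.le hz₀ hz₁ hσ (by linarith) hchord
    linarith
  · rw [Q_back _ huT, hback]
    dsimp only
    rw [norm_circlePt_sub,
      show (x + 2 * z - (1 + u - T) - -u) / 2 = π - y by rw [hT, hx]; linarith,
      Real.sin_pi_sub, abs_of_nonneg]
    · linarith
    · exact Real.sin_nonneg_of_nonneg_of_le_pi hy₀.le hy_pi
end
end

section
/- In the priority evacuation model with 2 servants, there exist trajectories Q, S₁, S₂ that evacuate the queen in time 3.8327. -/
open Real Set MeasureTheory
open scoped RealInnerProductSpace

noncomputable section

/-! ### Taylor bounds for sine and cosine -/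

lemma nonneg_of_hasDerivAt_nonneg {f f' : ℝ → ℝ} (hf : ∀ x, HasDerivAt f (f' x) x)
    (h0 : f 0 = 0) (h : ∀ x, 0 ≤ x → 0 ≤ f' x) {x : ℝ} (hx : 0 ≤ x) : 0 ≤ f x := by
  have hmono : MonotoneOn f (Ici 0) := by
    refine monotoneOn_of_deriv_nonneg (convex_Ici 0)
      (fun y _ => (hf y).continuousAt.continuousWithinAt)
      (fun y _ => (hf y).differentiableAt.differentiableWithinAt) fun y hy => ?_
    rw [interior_Ici] at hy
    rw [(hf y).deriv]
    exact h y (le_of_lt hy)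
  simpa [h0] using hmono (mem_Ici.2 le_rfl) (mem_Ici.2 hx) hx

lemma cos_le_taylor_four {x : ℝ} (hx : 0 ≤ x) : cos x ≤ 1 - x ^ 2 / 2 + x ^ 4 / 24 := by
  refine sub_nonneg.1 (nonneg_of_hasDerivAt_nonneg (f := fun y => 1 - y ^ 2 / 2 + y ^ 4 / 24 - cos y)
    (f' := fun y => sin y - (y - y ^ 3 / 6)) (fun y => ?_) (by simp)
    (fun y hy => sub_nonneg.2 (sin_ge_sub_cube hy)) hx)
  refine HasDerivAt.congr_deriv (((((hasDerivAt_pow 2 y).div_const 2).const_sub 1).add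
    ((hasDerivAt_pow 4 y).div_const 24)).sub (hasDerivAt_cos y)) ?_
  push_cast
  ring

lemma sin_le_taylor_five {x : ℝ} (hx : 0 ≤ x) : sin x ≤ x - x ^ 3 / 6 + x ^ 5 / 120 := by
  refine sub_nonneg.1 (nonneg_of_hasDerivAt_nonneg (f := fun y => y - y ^ 3 / 6 + y ^ 5 / 120 - sin y)
    (f' := fun y => 1 - y ^ 2 / 2 + y ^ 4 / 24 - cos y) (fun y => ?_) (by simp)
    (fun y hy => sub_nonneg.2 (cos_le_taylor_four hy)) hx)
  refine HasDerivAt.congr_deriv ((((hasDerivAt_id y).sub ((hasDerivAt_pow 3 y).div_const 6)).add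
    ((hasDerivAt_pow 5 y).div_const 120)).sub (hasDerivAt_sin y)) ?_
  push_cast
  ring

lemma taylor_six_le_cos {x : ℝ} (hx : 0 ≤ x) :
    1 - x ^ 2 / 2 + x ^ 4 / 24 - x ^ 6 / 720 ≤ cos x := by
  refine sub_nonneg.1 (nonneg_of_hasDerivAt_nonneg
    (f := fun y => cos y - (1 - y ^ 2 / 2 + y ^ 4 / 24 - y ^ 6 / 720))
    (f' := fun y => y - y ^ 3 / 6 + y ^ 5 / 120 - sin y) (fun y => ?_) (by simp)
    (fun y hy => sub_nonneg.2 (sin_le_taylor_five hy)) hx)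
  refine HasDerivAt.congr_deriv ((hasDerivAt_cos y).sub
    (((((hasDerivAt_pow 2 y).div_const 2).const_sub 1).add
    ((hasDerivAt_pow 4 y).div_const 24)).sub ((hasDerivAt_pow 6 y).div_const 720))) ?_
  push_cast
  ring

lemma taylor_seven_le_sin {x : ℝ} (hx : 0 ≤ x) :
    x - x ^ 3 / 6 + x ^ 5 / 120 - x ^ 7 / 5040 ≤ sin x := by
  refine sub_nonneg.1 (nonneg_of_hasDerivAt_nonneg
    (f := fun y => sin y - (y - y ^ 3 / 6 + y ^ 5 / 120 - y ^ 7 / 5040))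
    (f' := fun y => cos y - (1 - y ^ 2 / 2 + y ^ 4 / 24 - y ^ 6 / 720)) (fun y => ?_) (by simp)
    (fun y hy => sub_nonneg.2 (taylor_six_le_cos hy)) hx)
  refine HasDerivAt.congr_deriv ((hasDerivAt_sin y).sub ((((hasDerivAt_id y).sub
    ((hasDerivAt_pow 3 y).div_const 6)).add ((hasDerivAt_pow 5 y).div_const 120)).sub
    ((hasDerivAt_pow 7 y).div_const 5040))) ?_
  push_cast
  ring

/-! ### Points of the plane and unit-speed motions -/

/-- The point with coordinates `x` and `y`. -/
def pt (x y : ℝ) : Plane := !₂[x, y]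

lemma pt_zero : pt 0 0 = 0 := by
  ext i; fin_cases i <;> simp [pt]

lemma norm_pt_sub_pt (a b c d : ℝ) : ‖pt a b - pt c d‖ = √((a - c) ^ 2 + (b - d) ^ 2) := by
  simp [pt, EuclideanSpace.norm_eq, Fin.sum_univ_two]

lemma norm_pt_sub_pt_le {a b c d r : ℝ} (hr : 0 ≤ r) (h : (a - c) ^ 2 + (b - d) ^ 2 ≤ r ^ 2) :
    ‖pt a b - pt c d‖ ≤ r := by
  rw [norm_pt_sub_pt]
  exact Real.sqrt_le_iff.2 ⟨hr, h⟩

lemma exists_eq_pt_cos_sin {p : Plane} (hp : ‖p‖ = 1) :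
    ∃ θ : ℝ, -π < θ ∧ θ ≤ π ∧ p = pt (cos θ) (sin θ) := by
  have h : p 0 ^ 2 + p 1 ^ 2 = 1 := by
    have := EuclideanSpace.real_norm_sq_eq p
    rw [hp, Fin.sum_univ_two] at this
    linarith
  set z : ℂ := ⟨p 0, p 1⟩ with hz
  have hn : ‖z‖ = 1 := by
    rw [Complex.norm_eq_sqrt_sq_add_sq]
    simp [hz, h]
  refine ⟨Complex.arg z, Complex.neg_pi_lt_arg z, Complex.arg_le_pi z, ?_⟩
  have h1 := Complex.norm_mul_cos_arg z
  have h2 := Complex.norm_mul_sin_arg z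
  rw [hn, one_mul] at h1 h2
  rw [h1, h2]
  ext i; fin_cases i <;> simp [pt, hz]

lemma lipschitzOnWith_pt {x y : ℝ → ℝ} {s : Set ℝ}
    (h : ∀ a b, (x a - x b) ^ 2 + (y a - y b) ^ 2 ≤ (a - b) ^ 2) :
    LipschitzOnWith 1 (fun t => pt (x t) (y t)) s := by
  refine LipschitzOnWith.of_dist_le_mul fun a _ b _ => ?_
  rw [dist_eq_norm, Real.dist_eq, NNReal.coe_one, one_mul]
  exact norm_pt_sub_pt_le (abs_nonneg _) (by rw [sq_abs]; exact h a b)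

lemma cos_sub_cos_sq_add_sin_sub_sin_sq_le (u v : ℝ) :
    (cos u - cos v) ^ 2 + (sin u - sin v) ^ 2 ≤ (u - v) ^ 2 := by
  have h := one_sub_sq_div_two_le_cos (x := u - v)
  rw [cos_sub] at h
  nlinarith [sin_sq_add_cos_sq u, sin_sq_add_cos_sq v]

/-- The uniform motion that is at `(a, b)` at time `s` and at `(c, d)` at time `e`. -/
def uniformMotion (a b c d s e t : ℝ) : Plane :=
  pt (a + (c - a) * ((t - s) / (e - s))) (b + (d - b) * ((t - s) / (e - s)))

lemma uniformMotion_start (a b c d s e : ℝ) : uniformMotion a b c d s e s = pt a b := by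
  simp [uniformMotion]

lemma uniformMotion_end (a b c d : ℝ) {s e : ℝ} (h : s < e) :
    uniformMotion a b c d s e e = pt c d := by
  simp [uniformMotion, div_self (sub_pos.2 h).ne']

lemma lipschitzOnWith_uniformMotion {a b c d s e : ℝ} (hse : s < e)
    (h : (c - a) ^ 2 + (d - b) ^ 2 ≤ (e - s) ^ 2) (A : Set ℝ) :
    LipschitzOnWith 1 (uniformMotion a b c d s e) A := by
  refine lipschitzOnWith_pt fun u v => ?_
  have hpos : 0 < (e - s) ^ 2 := by have := sub_pos.2 hse; positivity
  have hne : e - s ≠ 0 := (sub_pos.2 hse).ne'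
  calc _ = ((c - a) ^ 2 + (d - b) ^ 2) / (e - s) ^ 2 * (u - v) ^ 2 := by field_simp; ring
    _ ≤ 1 * (u - v) ^ 2 := by
        gcongr
        exact (div_le_one hpos).2 h
    _ = (u - v) ^ 2 := one_mul _

lemma lipschitzOnWith_ite {E : Type*} [PseudoMetricSpace E] {f g : ℝ → E} {a c : ℝ}
    (hf : LipschitzOnWith 1 f (Icc a c)) (hg : LipschitzOnWith 1 g (Ici c)) (h : f c = g c) :
    LipschitzOnWith 1 (fun t => if t ≤ c then f t else g t) (Ici a) := by
  have key : ∀ x ∈ Ici a, ∀ y ∈ Ici a, x ≤ y →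
      dist (if x ≤ c then f x else g x) (if y ≤ c then f y else g y) ≤ y - x := by
    intro x hx y _ hxy
    rw [mem_Ici] at hx
    by_cases hy : y ≤ c
    · have h1 := hf.dist_le_mul x ⟨hx, hxy.trans hy⟩ y ⟨hx.trans hxy, hy⟩
      rw [if_pos hy, if_pos (hxy.trans hy)]
      rwa [NNReal.coe_one, one_mul, dist_comm x, Real.dist_eq, abs_of_nonneg (by linarith)] at h1
    · have hy' : c ≤ y := le_of_not_ge hy
      rw [if_neg hy]
      by_cases hxc : x ≤ c
      · rw [if_pos hxc]
        have h1 := hf.dist_le_mul x ⟨hx, hxc⟩ c ⟨hx.trans hxc, le_rfl⟩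
        have h2 := hg.dist_le_mul c (mem_Ici.2 le_rfl) y hy'
        rw [NNReal.coe_one, one_mul, Real.dist_eq, abs_of_nonpos (by linarith)] at h1 h2
        have := dist_triangle (f x) (f c) (g y)
        rw [h] at h1 this
        linarith
      · have h2 := hg.dist_le_mul x (le_of_not_ge hxc) y hy'
        rw [if_neg hxc]
        rwa [NNReal.coe_one, one_mul, dist_comm x, Real.dist_eq,
          abs_of_nonneg (by linarith)] at h2
  refine LipschitzOnWith.of_dist_le_mul fun x hx y hy => ?_
  rw [NNReal.coe_one, one_mul, Real.dist_eq]
  rcases le_total x y with hxy | hxy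
  · rw [abs_sub_comm, abs_of_nonneg (sub_nonneg.2 hxy)]
    exact key x hx y hy hxy
  · rw [abs_of_nonneg (sub_nonneg.2 hxy), dist_comm]
    exact key y hy x hx hxy

/-! ### Evacuation from a late visit -/

/-- The evacuation time `t + ‖Q t - p‖` is monotone in `t`, so it may be estimated at any time
not earlier than some visit of `p`. -/
lemma evacuates_of_forall_exists {n : ℕ} {Q : ℝ → Plane} {S : Fin n → ℝ → Plane} {B : ℝ}
    (hQ : IsTraj Q)
    (h : ∀ p : Plane, ‖p‖ = 1 → ∃ t t', 0 ≤ t ∧ t ≤ t' ∧ (Q t = p ∨ ∃ i, S i t = p) ∧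
      t' + ‖Q t' - p‖ ≤ B) :
    Evacuates Q S B := by
  intro p hp
  obtain ⟨t, t', ht, htt', hv, hB⟩ := h p hp
  refine ⟨⟨t, ht, hv⟩, ?_⟩
  have h0 : 0 ≤ visitTime Q S p := Real.sInf_nonneg fun s hs => hs.1
  have hbdd : BddBelow {s : ℝ | 0 ≤ s ∧ (Q s = p ∨ ∃ i, S i s = p)} := ⟨0, fun s hs => hs.1⟩
  have hle : visitTime Q S p ≤ t' := (csInf_le hbdd ⟨ht, hv⟩).trans htt'
  have hlip := hQ.1.dist_le_mul _ (mem_Ici.2 h0) _ (mem_Ici.2 (h0.trans hle))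
  rw [NNReal.coe_one, one_mul, Real.dist_eq, abs_sub_comm, abs_of_nonneg (sub_nonneg.2 hle),
    dist_eq_norm] at hlip
  have := norm_sub_le_norm_sub_add_norm_sub (Q (visitTime Q S p)) (Q t') p
  linarith

/-! ### The trajectories

The servants start at the points of the circle at angles `± 2.82359` and search towards the
point at angle `0`, which they reach at time `3.82359`. The queen first searches the remaining
arc, then enters the disk, and finally moves along the horizontal axis. -/

/-- The servants' trajectories, for `σ = 1` and `σ = -1`. -/
def servant (σ t : ℝ) : Plane :=
  if t ≤ 1 then uniformMotion 0 0 (cos 2.82359) (σ * sin 2.82359) 0 1 t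
  else pt (cos (3.82359 - t)) (σ * sin (3.82359 - t))

/-- The time at which the queen has searched her arc. -/
def departure : ℝ := 1 + 2 * (π - 2.82359)

/-- The queen's trajectory. -/
def queen (t : ℝ) : Plane :=
  if t ≤ 1 then uniformMotion 0 0 (cos 2.82359) (-sin 2.82359) 0 1 t
  else if t ≤ departure then pt (cos (1.82359 + t)) (-sin (1.82359 + t))
  else if t ≤ 2.53359 then
    uniformMotion (cos 2.82359) (sin 2.82359) (-0.07136305) 0.1285895 departure 2.53359 t
  else if t ≤ 3.21109 then
    pt (1.19518475 - 0.98182 * (3.82359 - t)) (0.1898 * (3.21109 - t))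
  else if t ≤ 3.57359 then pt (1.20632 - (3.82359 - t)) 0
  else pt (1 - 0.17472 * (3.82359 - t)) 0

lemma isTraj_servant {σ : ℝ} (hσ : σ ^ 2 = 1) : IsTraj (servant σ) := by
  refine ⟨lipschitzOnWith_ite ?_ ?_ ?_, ?_⟩
  · refine lipschitzOnWith_uniformMotion one_pos ?_ _
    nlinarith [sin_sq_add_cos_sq (2.82359 : ℝ)]
  · refine lipschitzOnWith_pt fun a b => ?_
    have := cos_sub_cos_sq_add_sin_sub_sin_sq_le (3.82359 - a) (3.82359 - b)
    rw [← mul_sub, mul_pow, hσ]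
    linarith
  · rw [uniformMotion_end _ _ _ _ one_pos]
    norm_num
  · rw [servant, if_pos zero_le_one, uniformMotion_start, pt_zero]

lemma departure_bounds : 1.636005307 < departure ∧ departure < 1.636005308 := by
  have h1 := pi_gt_d20
  have h2 := pi_lt_d20
  unfold departure
  constructor <;> linarith

lemma first_leg_speed : (-0.07136305 - cos 2.82359) ^ 2 + (0.1285895 - sin 2.82359) ^ 2
    ≤ (2.53359 - departure) ^ 2 := by
  obtain ⟨h1, h2⟩ := departure_bounds
  obtain ⟨α, hα⟩ : ∃ α, α = π - 2.82359 := ⟨_, rfl⟩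
  have hd : departure = 1 + 2 * α := by rw [hα, departure]
  rw [hd] at h1 h2
  have hl : 0.318002653 ≤ α := by linarith
  have hu : α ≤ 0.318002654 := by linarith
  have e : (2.82359 : ℝ) = π - α := by rw [hα]; ring
  have hc := taylor_six_le_cos (x := α) (by linarith)
  have hs := taylor_seven_le_sin (x := α) (by linarith)
  have hu2 : α ^ 2 ≤ 0.318002654 ^ 2 := by gcongr
  have hu3 : α ^ 3 ≤ 0.318002654 ^ 3 := by gcongr
  have hu7 : α ^ 7 ≤ 0.318002654 ^ 7 := by gcongr
  have hl4 : 0.318002653 ^ 4 ≤ α ^ 4 := by gcongr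
  have hl5 : 0.318002653 ^ 5 ≤ α ^ 5 := by gcongr
  have hu6 : α ^ 6 ≤ 0.318002654 ^ 6 := by gcongr
  have hr : (2.53359 - 1.636005308) ^ 2 ≤ (2.53359 - departure) ^ 2 := by
    gcongr
    linarith
  rw [e, cos_pi_sub, sin_pi_sub]
  linarith [sin_sq_add_cos_sq α]

lemma isTraj_queen : IsTraj queen := by
  obtain ⟨h1, h2⟩ := departure_bounds
  refine ⟨?_, by rw [queen, if_pos zero_le_one, uniformMotion_start, pt_zero]⟩
  refine lipschitzOnWith_ite (lipschitzOnWith_uniformMotion one_pos ?_ _)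
    (lipschitzOnWith_ite (lipschitzOnWith_pt fun a b => ?_)
      (lipschitzOnWith_ite (lipschitzOnWith_uniformMotion (by linarith) first_leg_speed _)
        (lipschitzOnWith_ite (lipschitzOnWith_pt fun a b => ?_)
          (lipschitzOnWith_ite (lipschitzOnWith_pt fun a b => ?_)
            (lipschitzOnWith_pt fun a b => ?_) ?_) ?_) ?_) ?_) ?_
  · nlinarith [sin_sq_add_cos_sq (2.82359 : ℝ)]
  · have := cos_sub_cos_sq_add_sin_sub_sin_sq_le (1.82359 + a) (1.82359 + b)
    linarith
  · nlinarith [sq_nonneg (a - b)]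
  · nlinarith [sq_nonneg (a - b)]
  · nlinarith [sq_nonneg (a - b)]
  · norm_num
  · norm_num
  · rw [if_pos (by norm_num), uniformMotion_end _ _ _ _ (by linarith)]
    norm_num
  · rw [if_pos (by linarith), uniformMotion_start]
    have : 1.82359 + departure = 2 * π - 2.82359 := by unfold departure; ring
    rw [this, cos_two_pi_sub, sin_two_pi_sub, neg_neg]
  · rw [if_pos (by linarith), uniformMotion_end _ _ _ _ one_pos]
    norm_num

/-! ### Distance from the queen to the servants -/

lemma diagonal_leg_bound {x : ℝ} (h : 0.6125 ≤ x) (h' : x ≤ 1.15) :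
    0 ≤ (x + 0.00911) ^ 2 - 1 - (1.19518475 - 0.98182 * x) ^ 2 - (0.1898 * (x - 0.6125)) ^ 2
      + 2 * (1.19518475 - 0.98182 * x) * (1 - x ^ 2 / 2 + x ^ 4 / 24 - x ^ 6 / 720)
      - 2 * (0.1898 * (x - 0.6125)) * (x - x ^ 3 / 6 + x ^ 5 / 120) := by
  rcases le_total x 0.714 with hx | hx
  · obtain ⟨s, rfl⟩ : ∃ s, x = 0.714 - s := ⟨0.714 - x, by ring⟩
    have hs : 0 ≤ s := by linarith
    have key := fun k : ℕ => mul_nonneg (pow_nonneg hs k) (by linarith : 0 ≤ 0.1015 - s)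
    linarith [key 2, key 3, key 4, key 5, key 6, pow_nonneg hs 3, pow_nonneg hs 4,
      pow_nonneg hs 5, pow_nonneg hs 6, pow_nonneg hs 7, sq_nonneg (s - 0.0005)]
  · obtain ⟨s, rfl⟩ : ∃ s, x = 0.714 + s := ⟨x - 0.714, by ring⟩
    have hs : 0 ≤ s := by linarith
    have key := fun k : ℕ => mul_nonneg (pow_nonneg hs k) (by linarith : 0 ≤ 0.436 - s)
    linarith [key 2, key 3, key 4, key 5, key 6, pow_nonneg hs 2, pow_nonneg hs 3,
      pow_nonneg hs 4, pow_nonneg hs 5, pow_nonneg hs 6, pow_nonneg hs 7]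

lemma fast_axis_leg_bound {x : ℝ} (h : 0.25 ≤ x) (h' : x ≤ 0.6125) :
    0 ≤ (x + 0.00911) ^ 2 - 1 - (1.20632 - x) ^ 2
      + 2 * (1.20632 - x) * (1 - x ^ 2 / 2 + x ^ 4 / 24 - x ^ 6 / 720) := by
  rcases le_total x 0.502 with hx | hx
  · obtain ⟨s, rfl⟩ : ∃ s, x = 0.502 - s := ⟨0.502 - x, by ring⟩
    have hs : 0 ≤ s := by linarith
    have key := fun k : ℕ => mul_nonneg (pow_nonneg hs k) (by linarith : 0 ≤ 0.252 - s)
    linarith [key 1, key 2, key 3, key 4, key 5, key 6, pow_nonneg hs 3, pow_nonneg hs 4,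
      pow_nonneg hs 5, pow_nonneg hs 6, pow_nonneg hs 7]
  · obtain ⟨s, rfl⟩ : ∃ s, x = 0.502 + s := ⟨x - 0.502, by ring⟩
    have hs : 0 ≤ s := by linarith
    have key := fun k : ℕ => mul_nonneg (pow_nonneg hs k) (by linarith : 0 ≤ 0.1105 - s)
    linarith [key 2, key 3, key 4, key 5, key 6, pow_nonneg hs 3, pow_nonneg hs 4,
      pow_nonneg hs 5, pow_nonneg hs 6, pow_nonneg hs 7, sq_nonneg (s - 0.0003)]

lemma slow_axis_leg_bound {x : ℝ} (h : 0 ≤ x) (h' : x ≤ 0.25) :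
    0 ≤ (x + 0.00911) ^ 2 - 1 - (1 - 0.17472 * x) ^ 2
      + 2 * (1 - 0.17472 * x) * (1 - x ^ 2 / 2 + x ^ 4 / 24 - x ^ 6 / 720) := by
  have key := fun k : ℕ => mul_nonneg (pow_nonneg h k) (by linarith : 0 ≤ 0.25 - x)
  linarith [key 1, key 2, key 3, key 4, key 5, key 6, pow_nonneg h 3, pow_nonneg h 4,
    pow_nonneg h 5, pow_nonneg h 6, pow_nonneg h 7]

lemma norm_sub_circle_le {a b x : ℝ} {σ : ℝ} (hσ : σ ^ 2 = 1) (hx : 0 ≤ x) (hx' : x ≤ 1.15)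
    (ha : 0 ≤ a) (hb : 0 ≤ b)
    (h : 0 ≤ (x + 0.00911) ^ 2 - 1 - a ^ 2 - b ^ 2
      + 2 * a * (1 - x ^ 2 / 2 + x ^ 4 / 24 - x ^ 6 / 720)
      - 2 * b * (x - x ^ 3 / 6 + x ^ 5 / 120)) :
    ‖pt a b - pt (cos x) (σ * sin x)‖ ≤ x + 0.00911 := by
  refine norm_pt_sub_pt_le (by linarith) ?_
  have hc := mul_le_mul_of_nonneg_left (taylor_six_le_cos hx) ha
  have hs := mul_le_mul_of_nonneg_left (sin_le_taylor_five hx) hb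
  have hs0 : 0 ≤ b * sin x :=
    mul_nonneg hb (sin_nonneg_of_nonneg_of_le_pi hx (by linarith [pi_gt_three]))
  have hσ' : -1 ≤ σ := by nlinarith
  have : -(b * sin x) ≤ σ * (b * sin x) := by nlinarith
  nlinarith [sin_sq_add_cos_sq x]

lemma evacuation_bound {σ x : ℝ} (hσ : σ ^ 2 = 1) (hx : 0 ≤ x) (hx' : x ≤ 1.15) :
    3.82359 - x + ‖queen (3.82359 - x) - pt (cos x) (σ * sin x)‖ ≤ 3.8327 := by
  obtain ⟨h1, h2⟩ := departure_bounds
  suffices ‖queen (3.82359 - x) - pt (cos x) (σ * sin x)‖ ≤ x + 0.00911 by linarith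
  rw [queen, if_neg (by linarith), if_neg (by linarith), if_neg (by linarith)]
  split_ifs with h3 h4
  · refine norm_sub_circle_le hσ hx hx' (by linarith) (by linarith) ?_
    convert diagonal_leg_bound (by linarith) hx' using 1
    ring
  · refine norm_sub_circle_le hσ hx hx' (by linarith) le_rfl ?_
    convert fast_axis_leg_bound (x := x) (by linarith) (by linarith) using 1
    ring
  · refine norm_sub_circle_le hσ hx hx' (by linarith) le_rfl ?_
    convert slow_axis_leg_bound (x := x) hx (by linarith) using 1
    ring

lemma servant_visit (σ : ℝ) {x : ℝ} (hx' : x ≤ 2.82359) :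
    servant σ (3.82359 - x) = pt (cos x) (σ * sin x) := by
  rcases hx'.eq_or_lt with rfl | hlt
  · rw [servant, if_pos (by norm_num)]
    convert uniformMotion_end _ _ _ _ one_pos using 2
    norm_num
  · rw [servant, if_neg (by linarith), sub_sub_cancel]

lemma exists_late_visit {σ x : ℝ} (hσ : σ ^ 2 = 1) (hx : 0 ≤ x) (hx' : x ≤ 2.82359) :
    ∃ t t', 0 ≤ t ∧ t ≤ t' ∧ servant σ t = pt (cos x) (σ * sin x) ∧
      t' + ‖queen t' - pt (cos x) (σ * sin x)‖ ≤ 3.8327 := by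
  obtain ⟨h1, h2⟩ := departure_bounds
  rcases le_total x 1.15 with h | h
  · exact ⟨3.82359 - x, 3.82359 - x, by linarith, le_rfl, servant_visit σ hx',
      evacuation_bound hσ hx h⟩
  · refine ⟨3.82359 - x, 2.67359, by linarith, by linarith, servant_visit σ hx', ?_⟩
    suffices ‖queen 2.67359 - pt (cos x) (σ * sin x)‖ ≤ 1.15911 by linarith
    rw [queen, if_neg (by norm_num), if_neg (by linarith), if_neg (by norm_num),
      if_pos (by norm_num)]
    refine norm_pt_sub_pt_le (by norm_num) ?_
    have hs : (σ * sin x) ^ 2 = sin x ^ 2 := by rw [mul_pow, hσ, one_mul]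
    have hb : |σ * sin x| ≤ 1 := abs_le_one_iff_mul_self_le_one.2 (by
      nlinarith [sin_sq_le_one x])
    nlinarith [sin_sq_add_cos_sq x, neg_one_le_cos x, cos_le_one x, neg_le_of_abs_le hb,
      sq_nonneg (cos x + 0.54), sq_nonneg (σ * sin x + 0.84)]

lemma queen_visit {t : ℝ} (h : 1 < t) (h' : t ≤ departure) :
    queen t = pt (cos (1.82359 + t)) (-sin (1.82359 + t)) := by
  rw [queen, if_neg (by linarith), if_pos h']

/-- with two servants the queen can be evacuated in time `3.8327`. -/
theorem priority_evacuation_two_servants_upper_bound :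
    ∃ Q S₁ S₂ : ℝ → Plane, IsTraj Q ∧ IsTraj S₁ ∧ IsTraj S₂ ∧
      Evacuates Q ![S₁, S₂] (3.8327 : ℝ) := by
  refine ⟨queen, servant 1, servant (-1), isTraj_queen, isTraj_servant (by norm_num),
    isTraj_servant (by norm_num), evacuates_of_forall_exists isTraj_queen fun p hp => ?_⟩
  obtain ⟨θ, hl, hu, rfl⟩ := exists_eq_pt_cos_sin hp
  obtain ⟨h1, h2⟩ := departure_bounds
  have hd : departure = 1 + 2 * (π - 2.82359) := rfl
  rcases lt_or_ge 2.82359 θ with h | h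
  · have hv : queen (2 * π - 1.82359 - θ) = pt (cos θ) (sin θ) := by
      rw [queen_visit (by linarith) (by linarith),
        show 1.82359 + (2 * π - 1.82359 - θ) = 2 * π - θ by ring, cos_two_pi_sub, sin_two_pi_sub,
        neg_neg]
    refine ⟨2 * π - 1.82359 - θ, _, by linarith, le_rfl, Or.inl hv, ?_⟩
    rw [hv, sub_self, norm_zero]
    linarith
  rcases lt_or_ge θ (-2.82359) with h' | h'
  · have hv : queen (-1.82359 - θ) = pt (cos θ) (sin θ) := by
      rw [queen_visit (by linarith) (by linarith),
        show 1.82359 + (-1.82359 - θ) = -θ by ring, cos_neg, sin_neg, neg_neg]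
    refine ⟨-1.82359 - θ, _, by linarith, le_rfl, Or.inl hv, ?_⟩
    rw [hv, sub_self, norm_zero]
    linarith
  rcases le_total 0 θ with h0 | h0
  · obtain ⟨t, t', ht, htt', hv, hB⟩ := exists_late_visit (σ := 1) (by norm_num) h0 h
    rw [one_mul] at hv hB
    exact ⟨t, t', ht, htt', Or.inr ⟨0, hv⟩, hB⟩
  · obtain ⟨t, t', ht, htt', hv, hB⟩ :=
      exists_late_visit (σ := -1) (x := -θ) (by norm_num) (by linarith) (by linarith)
    rw [cos_neg, sin_neg, neg_one_mul, neg_neg] at hv hB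
    exact ⟨t, t', ht, htt', Or.inr ⟨1, hv⟩, hB⟩
end
end

section
/- In the priority evacuation model with 1 servant, for every pair of trajectories Q, S₁ and every real B, if Q, S₁ evacuate the queen in time B then B ≥ 3 + π/6 + √3/2 (≈ 4.3896). -/
open Real Set MeasureTheory
open scoped RealInnerProductSpace

noncomputable section

instance fact_zero_lt_two_pi : Fact (0 < 2 * π) := ⟨Real.two_pi_pos⟩

/-- The point of the unit circle with angle `θ` modulo `2π`. -/
def anglePt (θ : AddCircle (2 * π)) : Plane :=
  !₂[Real.Angle.cos θ, Real.Angle.sin θ]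

lemma plane_norm_sq (v : Plane) : ‖v‖ ^ 2 = v 0 ^ 2 + v 1 ^ 2 := by
  simp [EuclideanSpace.norm_sq_eq, Fin.sum_univ_two]

lemma norm_anglePt (θ : AddCircle (2 * π)) : ‖anglePt θ‖ = 1 := by
  have h := plane_norm_sq (anglePt θ)
  have h' : ‖anglePt θ‖ ^ 2 = 1 := by
    rw [h]
    simpa [anglePt] using Real.Angle.cos_sq_add_sin_sq θ
  nlinarith [norm_nonneg (anglePt θ)]

lemma norm_anglePt_sub_smul_sq (θ α : AddCircle (2 * π)) (R : ℝ) :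
    ‖anglePt θ - R • anglePt α‖ ^ 2 =
      1 + R ^ 2 - 2 * R * Real.Angle.cos (θ - α : AddCircle (2 * π)) := by
  induction θ using QuotientAddGroup.induction_on with | _ x
  induction α using QuotientAddGroup.induction_on with | _ a
  have hcos : Real.Angle.cos ((x : AddCircle (2 * π)) - (a : AddCircle (2 * π))) =
      Real.cos (x - a) := Real.Angle.cos_coe (x - a)
  have hx : anglePt (x : AddCircle (2 * π)) = !₂[Real.cos x, Real.sin x] := rfl
  have ha : anglePt (a : AddCircle (2 * π)) = !₂[Real.cos a, Real.sin a] := rfl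
  rw [plane_norm_sq]
  erw [hcos, hx, ha]
  simp only [PiLp.sub_apply, PiLp.smul_apply, smul_eq_mul, Real.cos_sub]
  simp
  nlinarith [Real.sin_sq_add_cos_sq x, Real.sin_sq_add_cos_sq a]

lemma exists_eq_smul_anglePt (c : Plane) :
    ∃ R : ℝ, 0 ≤ R ∧ ∃ α : AddCircle (2 * π), c = R • anglePt α := by
  refine ⟨‖(⟨c 0, c 1⟩ : ℂ)‖, norm_nonneg _,
    ((Complex.arg ⟨c 0, c 1⟩ : ℝ) : AddCircle (2 * π)), ?_⟩
  have ha (a : ℝ) : anglePt (a : AddCircle (2 * π)) = !₂[Real.cos a, Real.sin a] := rfl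
  rw [ha]
  ext i
  fin_cases i
  · simp [Complex.norm_mul_cos_arg]
  · simp [Complex.norm_mul_sin_arg]

lemma exists_eq_anglePt {p : Plane} (hp : ‖p‖ = 1) :
    ∃ α : AddCircle (2 * π), p = anglePt α := by
  obtain ⟨R, hR, α, h⟩ := exists_eq_smul_anglePt p
  have hR1 : R = 1 := by
    rw [h, norm_smul, norm_anglePt, mul_one, Real.norm_of_nonneg hR] at hp
    exact hp
  exact ⟨α, by rw [h, hR1, one_smul]⟩

lemma norm_le_of_cos_le {y : ℝ} (hy0 : 0 ≤ y) (δ : AddCircle (2 * π))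
    (h : Real.cos y ≤ Real.Angle.cos δ) : ‖δ‖ ≤ y := by
  obtain ⟨x, rfl, hx⟩ : ∃ x : ℝ, (x : AddCircle (2 * π)) = δ ∧ |x| ≤ π :=
    ⟨Real.Angle.toReal δ, Real.Angle.coe_toReal δ, Real.Angle.abs_toReal_le_pi δ⟩
  refine (QuotientAddGroup.norm_mk_le_norm (m := x)).trans ?_
  rw [Real.norm_eq_abs]
  by_contra! hlt
  have hcos := Real.cos_lt_cos_of_nonneg_of_le_pi hy0 hx hlt
  rw [Real.cos_abs] at hcos
  exact absurd h (not_le.2 ((Real.Angle.cos_coe x).trans_lt hcos))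

lemma volume_le_of_cos_le {y : ℝ} (hy0 : 0 ≤ y) (α : AddCircle (2 * π))
    (E : Set (AddCircle (2 * π)))
    (hE : ∀ θ ∈ E, Real.cos y ≤ Real.Angle.cos (θ - α : AddCircle (2 * π))) :
    volume E ≤ ENNReal.ofReal (2 * y) := by
  have hsub : E ⊆ Metric.closedBall α y := fun θ hθ => by
    rw [Metric.mem_closedBall, dist_eq_norm]
    exact norm_le_of_cos_le hy0 _ (hE θ hθ)
  refine (measure_mono hsub).trans ?_
  rw [AddCircle.volume_closedBall]
  exact ENNReal.ofReal_le_ofReal (min_le_right _ _)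

lemma volume_anglePt_near_le (c : Plane) {y : ℝ} (hy0 : 0 ≤ y) (hy : y < π / 2) :
    volume {θ | ‖anglePt θ - c‖ ≤ Real.sin y} ≤ ENNReal.ofReal (2 * y) := by
  obtain ⟨R, hR, α, rfl⟩ := exists_eq_smul_anglePt c
  refine volume_le_of_cos_le hy0 α _ fun θ hθ => ?_
  have hcy : 0 < Real.cos y := Real.cos_pos_of_mem_Ioo ⟨by linarith, hy⟩
  have hsq : ‖anglePt θ - R • anglePt α‖ ^ 2 ≤ Real.sin y ^ 2 :=
    pow_le_pow_left₀ (norm_nonneg _) hθ 2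
  rw [norm_anglePt_sub_smul_sq] at hsq
  have hR0 : 0 < R := by
    rcases hR.eq_or_lt with h | h
    · subst h
      nlinarith [Real.sin_sq_add_cos_sq y]
    · exact h
  have : R * Real.cos y ≤ R * Real.Angle.cos (θ - α : AddCircle (2 * π)) := by
    nlinarith [Real.sin_sq_add_cos_sq y, sq_nonneg (R - Real.cos y)]
  exact le_of_mul_le_mul_left this hR0

lemma volume_anglePt_near_circle_le {p : Plane} (hp : ‖p‖ = 1) {ψ : ℝ} (hψ0 : 0 ≤ ψ) :
    volume {θ | ‖anglePt θ - p‖ ≤ 2 * Real.sin ψ} ≤ ENNReal.ofReal (4 * ψ) := by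
  obtain ⟨α, rfl⟩ := exists_eq_anglePt hp
  have h4 : 4 * ψ = 2 * (2 * ψ) := by ring
  rw [h4]
  refine volume_le_of_cos_le (by linarith) α _ fun θ hθ => ?_
  have hsq : ‖anglePt θ - anglePt α‖ ^ 2 ≤ (2 * Real.sin ψ) ^ 2 :=
    pow_le_pow_left₀ (norm_nonneg _) hθ 2
  have h := norm_anglePt_sub_smul_sq θ α 1
  rw [one_smul] at h
  rw [Real.cos_two_mul]
  nlinarith [Real.sin_sq_add_cos_sq ψ]

lemma IsTraj.norm_sub_le {f : ℝ → Plane} (hf : IsTraj f) {s t : ℝ} (hs : 0 ≤ s) (ht : 0 ≤ t) :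
    ‖f s - f t‖ ≤ |s - t| := by
  have h := hf.1.dist_le_mul s hs t ht
  rwa [NNReal.coe_one, one_mul, dist_eq_norm, Real.dist_eq] at h

lemma IsTraj.one_le_of_eq_anglePt {f : ℝ → Plane} (hf : IsTraj f) {s : ℝ} (hs : 0 ≤ s)
    {θ : AddCircle (2 * π)} (h : f s = anglePt θ) : 1 ≤ s := by
  have h1 := hf.norm_sub_le hs le_rfl
  rwa [hf.2, h, sub_zero, sub_zero, norm_anglePt, abs_of_nonneg hs] at h1

lemma IsTraj.volume_visited_le_aux {f : ℝ → Plane} (hf : IsTraj f) {t : ℝ} (ht : 1 ≤ t)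
    {h : ℝ} (h0 : 0 < h) (h1 : h ≤ 1 / 2) :
    volume {θ | ∃ s ∈ Icc 0 t, f s = anglePt θ} ≤
      ENNReal.ofReal ((t - 1 + h) * (1 + h ^ 2)) := by
  set N := ⌊(t - 1) / h⌋₊ + 1 with hN
  set m : ℕ → ℝ := fun j => 1 + (j + 1 / 2) * h with hm
  set y : ℝ := h / 2 + (h / 2) ^ 3 with hy
  have hy1 : y ≤ 1 / 2 := by
    have h2 : h / 2 ≤ 1 / 4 := by linarith
    have : (h / 2) ^ 3 ≤ (1 / 4) ^ 3 := pow_le_pow_left₀ (by positivity) h2 3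
    norm_num at this
    linarith
  have hy0 : 0 < y := by positivity
  have hsin : h / 2 ≤ Real.sin y := by
    have h3 := Real.sin_gt_sub_cube hy0
    have hyb : y ≤ h / 2 * (5 / 4) := by
      have : (h / 2) ^ 2 ≤ 1 / 4 := by nlinarith
      rw [hy]
      nlinarith
    have hy3 : y ^ 3 ≤ (h / 2 * (5 / 4)) ^ 3 := pow_le_pow_left₀ hy0.le hyb 3
    have : 0 < (h / 2) ^ 3 := by positivity
    rw [mul_pow] at hy3
    norm_num at hy3
    linarith
  have hcover : {θ | ∃ s ∈ Icc 0 t, f s = anglePt θ} ⊆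
      ⋃ j ∈ Finset.range N, {θ | ‖anglePt θ - f (m j)‖ ≤ Real.sin y} := by
    rintro θ ⟨s, ⟨hs0, hst⟩, hs⟩
    have hs1 := hf.one_le_of_eq_anglePt hs0 hs
    have hdiv : 0 ≤ (s - 1) / h := div_nonneg (by linarith) h0.le
    simp only [mem_iUnion, Finset.mem_range]
    refine ⟨⌊(s - 1) / h⌋₊, Nat.lt_succ_of_le (Nat.floor_le_floor (by gcongr)), ?_⟩
    rw [mem_ofPred_eq, ← hs]
    refine (hf.norm_sub_le hs0 (by simp only [hm]; positivity)).trans (le_trans ?_ hsin)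
    have hl := Nat.floor_le hdiv
    have hu := (Nat.lt_floor_add_one ((s - 1) / h)).le
    rw [le_div_iff₀ h0] at hl
    rw [div_le_iff₀ h0] at hu
    simp only [hm]
    rw [abs_le]
    constructor <;> nlinarith
  have hNh : N * h ≤ t - 1 + h := by
    have := Nat.floor_le (div_nonneg (by linarith : 0 ≤ t - 1) h0.le)
    rw [le_div_iff₀ h0] at this
    rw [hN]
    push_cast
    linarith
  calc volume {θ | ∃ s ∈ Icc 0 t, f s = anglePt θ}
      ≤ ∑ j ∈ Finset.range N, volume {θ | ‖anglePt θ - f (m j)‖ ≤ Real.sin y} :=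
        (measure_mono hcover).trans (measure_biUnion_finset_le _ _)
    _ ≤ ∑ j ∈ Finset.range N, ENNReal.ofReal (2 * y) :=
        Finset.sum_le_sum fun j _ => volume_anglePt_near_le _ hy0.le
          (by linarith [Real.pi_gt_three])
    _ = ENNReal.ofReal (N * (2 * y)) := by
        rw [Finset.sum_const, Finset.card_range, nsmul_eq_mul,
          ENNReal.ofReal_mul (Nat.cast_nonneg _), ENNReal.ofReal_natCast]
    _ ≤ ENNReal.ofReal ((t - 1 + h) * (1 + h ^ 2)) := by
        refine ENNReal.ofReal_le_ofReal ?_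
        have h2y : N * (2 * y) = N * h * (1 + h ^ 2 / 4) := by rw [hy]; ring
        rw [h2y]
        have : 0 ≤ t - 1 + h := by linarith
        gcongr
        nlinarith [sq_nonneg h]

/-- Up to time `t`, a trajectory visits a part of the unit circle of length at most `t - 1`. -/
lemma IsTraj.volume_visited_le {f : ℝ → Plane} (hf : IsTraj f) (t : ℝ) :
    volume {θ | ∃ s ∈ Icc 0 t, f s = anglePt θ} ≤ ENNReal.ofReal (t - 1) := by
  rcases lt_or_ge t 1 with ht | ht
  · have hempty : {θ | ∃ s ∈ Icc 0 t, f s = anglePt θ} = ∅ := by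
      refine eq_empty_of_forall_notMem ?_
      rintro θ ⟨s, ⟨hs0, hst⟩, hs⟩
      linarith [hf.one_le_of_eq_anglePt hs0 hs]
    rw [hempty, measure_empty]
    exact zero_le
  · have hc : Filter.Tendsto (fun h : ℝ => ENNReal.ofReal ((t - 1 + h) * (1 + h ^ 2)))
        (nhdsWithin 0 (Ioi 0)) (nhds (ENNReal.ofReal (t - 1))) := by
      have hcont : Continuous fun h : ℝ => ENNReal.ofReal ((t - 1 + h) * (1 + h ^ 2)) :=
        ENNReal.continuous_ofReal.comp (by fun_prop)
      have := hcont.tendsto 0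
      simp only [add_zero, ne_eq, OfNat.ofNat_ne_zero, not_false_eq_true, zero_pow,
        mul_one] at this
      exact this.mono_left nhdsWithin_le_nhds
    refine ge_of_tendsto hc ?_
    filter_upwards [Ioc_mem_nhdsGT (by norm_num : (0 : ℝ) < 1 / 2)] with h hh
    exact hf.volume_visited_le_aux ht hh.1 hh.2

/-- A point of the circle that is unvisited up to time `t` is at distance at most `B - t` from
the position of the queen at time `t`. -/
lemma Evacuates.norm_sub_le_of_not_visited {Q S₁ : ℝ → Plane} (hQ : IsTraj Q) {B : ℝ}
    (hB : Evacuates Q ![S₁] B) {t : ℝ} (ht : 0 ≤ t) {p : Plane} (hp : ‖p‖ = 1)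
    (hQp : ∀ s ∈ Icc 0 t, Q s ≠ p) (hSp : ∀ s ∈ Icc 0 t, S₁ s ≠ p) :
    ‖p - Q t‖ ≤ B - t := by
  obtain ⟨hne, hle⟩ := hB p hp
  have htv : t ≤ visitTime Q ![S₁] p := by
    refine le_csInf hne ?_
    rintro s ⟨hs0, hs | ⟨i, hs⟩⟩
    · by_contra! h
      exact hQp s ⟨hs0, h.le⟩ hs
    · by_contra! h
      refine hSp s ⟨hs0, h.le⟩ ?_
      simpa [Subsingleton.elim i 0] using hs
  have hl := hQ.norm_sub_le (ht.trans htv) ht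
  rw [abs_of_nonneg (by linarith)] at hl
  have htri := norm_sub_le_norm_sub_add_norm_sub p (Q (visitTime Q ![S₁] p)) (Q t)
  rw [norm_sub_rev p (Q (visitTime Q ![S₁] p))] at htri
  linarith

lemma two_pi_le_of_univ_subset {E F G : Set (AddCircle (2 * π))} {a b c : ℝ}
    (h : univ ⊆ E ∪ F ∪ G)
    (hE : volume E ≤ ENNReal.ofReal a) (hF : volume F ≤ ENNReal.ofReal b)
    (hG : volume G ≤ ENNReal.ofReal c) : 2 * π ≤ max a 0 + max b 0 + max c 0 := by
  have hu : ENNReal.ofReal (2 * π) ≤ ENNReal.ofReal (max a 0 + max b 0 + max c 0) := by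
    rw [← AddCircle.measure_univ (2 * π), ENNReal.ofReal_add (by positivity) (by positivity),
      ENNReal.ofReal_add (by positivity) (by positivity)]
    calc volume (univ : Set (AddCircle (2 * π))) ≤ volume (E ∪ F ∪ G) := measure_mono h
      _ ≤ volume E + volume F + volume G :=
        (measure_union_le _ _).trans (by gcongr; exact measure_union_le _ _)
      _ ≤ _ := by
        gcongr
        · exact hE.trans (ENNReal.ofReal_le_ofReal (le_max_left _ _))
        · exact hF.trans (ENNReal.ofReal_le_ofReal (le_max_left _ _))
        · exact hG.trans (ENNReal.ofReal_le_ofReal (le_max_left _ _))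
  exact (ENNReal.ofReal_le_ofReal_iff (by positivity)).1 hu

lemma sqrt_three_bounds : 1.73205 < Real.sqrt 3 ∧ Real.sqrt 3 < 1.73206 := by
  constructor
  · exact Real.lt_sqrt_of_sq_lt (by norm_num)
  · exact (Real.sqrt_lt' (by norm_num)).2 (by norm_num)

lemma mul_le_two_mul_sin {ψ : ℝ} (h0 : 0 ≤ ψ) (h1 : ψ ≤ π / 3) :
    1.65 * ψ ≤ 2 * Real.sin ψ := by
  have hpi := Real.pi_pos
  have hpi' := Real.pi_lt_d6
  have hc := strictConcaveOn_sin_Icc.concaveOn.2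
    (show (0 : ℝ) ∈ Icc 0 π from ⟨le_rfl, hpi.le⟩)
    (show π / 3 ∈ Icc 0 π from ⟨by positivity, by linarith⟩)
    (show 0 ≤ 1 - ψ / (π / 3) by
      rw [sub_nonneg, div_le_one (by positivity)]; exact h1)
    (show 0 ≤ ψ / (π / 3) by positivity) (by ring)
  simp only [smul_eq_mul, Real.sin_zero, mul_zero, zero_add, Real.sin_pi_div_three] at hc
  rw [div_mul_cancel₀ _ (by positivity)] at hc
  have hs := sqrt_three_bounds.1
  have : 1.65 * ψ ≤ 2 * (ψ / (π / 3) * (Real.sqrt 3 / 2)) := by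
    have he : 2 * (ψ / (π / 3) * (Real.sqrt 3 / 2)) = ψ * (3 * Real.sqrt 3 / π) := by
      field_simp
    rw [he, mul_comm]
    gcongr
    rw [le_div_iff₀ hpi]
    nlinarith
  linarith

/-- If the evacuation time is short, then the queen is on the circle at some time of
`[2.66, 3 + π / 6]`. -/
lemma exists_queen_on_circle {Q S₁ : ℝ → Plane} (hQ : IsTraj Q) (hS₁ : IsTraj S₁) {B : ℝ}
    (hB : Evacuates Q ![S₁] B) (hlt : B < 3 + π / 6 + Real.sqrt 3 / 2) :
    ∃ τ ∈ Icc (2.66 : ℝ) (3 + π / 6), ‖Q τ‖ = 1 := by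
  by_contra! hcon
  have hpi := Real.pi_gt_d6
  have hpi' := Real.pi_lt_d6
  have hcover : univ ⊆ {θ | ∃ s ∈ Icc 0 (3 + π / 6), S₁ s = anglePt θ} ∪
      {θ | ∃ s ∈ Icc 0 2.66, Q s = anglePt θ} ∪
      {θ | ‖anglePt θ - Q (3 + π / 6)‖ ≤ Real.sin (π / 3)} := by
    intro θ _
    by_contra hθ
    simp only [mem_union, mem_ofPred_eq, not_or, not_exists, not_and] at hθ
    obtain ⟨⟨h1, h2⟩, h3⟩ := hθ
    refine h3 ?_
    rw [Real.sin_pi_div_three]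
    refine (Evacuates.norm_sub_le_of_not_visited hQ hB (t := 3 + π / 6) (by positivity)
      (norm_anglePt θ) ?_ h1).trans (by linarith)
    rintro s ⟨hs0, hs⟩ heq
    rcases le_or_gt s 2.66 with h | h
    · exact h2 s ⟨hs0, h⟩ heq
    · exact hcon s ⟨h.le, hs⟩ (by rw [heq, norm_anglePt])
  have := two_pi_le_of_univ_subset hcover (hS₁.volume_visited_le _) (hQ.volume_visited_le _)
    (volume_anglePt_near_le _ (by positivity) (by linarith))
  rw [max_eq_left (by linarith), max_eq_left (by norm_num), max_eq_left (by linarith)] at this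
  linarith

/-- with one servant, any evacuation of the queen takes time at least
`3 + π/6 + √3/2 ≈ 4.3896`. -/
theorem priority_evacuation_one_servant_lower_bound
    (Q S₁ : ℝ → Plane) (hQ : IsTraj Q) (hS₁ : IsTraj S₁)
    (B : ℝ) (hB : Evacuates Q ![S₁] B) :
    3 + π / 6 + Real.sqrt 3 / 2 ≤ B := by
  by_contra! hlt
  obtain ⟨τ, ⟨hτ1, hτ2⟩, hτ⟩ := exists_queen_on_circle hQ hS₁ hB hlt
  have hpi := Real.pi_gt_d6
  have hpi' := Real.pi_lt_d6
  obtain ⟨h3, h3'⟩ := sqrt_three_bounds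
  set r : ℝ := 3 + π / 6 + Real.sqrt 3 / 2 - τ with hr
  have hr0 : Real.sqrt 3 / 2 ≤ r := by linarith
  have hr1 : r ≤ Real.sqrt 3 := by linarith
  set ψ : ℝ := Real.arcsin (r / 2) with hψ
  have hψ0 : 0 ≤ ψ := Real.arcsin_nonneg.2 (by linarith)
  have hψ1 : ψ ≤ π / 3 := by
    rw [hψ, Real.arcsin_le_iff_le_sin' ⟨by linarith, by linarith⟩, Real.sin_pi_div_three]
    linarith
  have hrψ : 2 * Real.sin ψ = r := by
    rw [hψ, Real.sin_arcsin (by linarith) (by linarith)]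
    ring
  have hψr : 1.65 * ψ ≤ r := hrψ ▸ mul_le_two_mul_sin hψ0 hψ1
  have hcover : univ ⊆ {θ | ∃ s ∈ Icc 0 τ, S₁ s = anglePt θ} ∪
      {θ | ∃ s ∈ Icc 0 (τ - r), Q s = anglePt θ} ∪
      {θ | ‖anglePt θ - Q τ‖ ≤ 2 * Real.sin ψ} := by
    intro θ _
    by_contra hθ
    simp only [mem_union, mem_ofPred_eq, not_or, not_exists, not_and] at hθ
    obtain ⟨⟨h1, h2⟩, h3⟩ := hθ
    refine h3 ?_
    rw [hrψ]
    by_cases hv : ∃ s ∈ Icc 0 τ, Q s = anglePt θ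
    · obtain ⟨s, ⟨hs0, hs⟩, heq⟩ := hv
      have hsr : τ - r < s := by
        by_contra! h
        exact h2 s ⟨hs0, h⟩ heq
      rw [← heq]
      refine (hQ.norm_sub_le hs0 (by linarith)).trans ?_
      rw [abs_sub_comm, abs_of_nonneg (by linarith)]
      linarith
    · push Not at hv
      exact (Evacuates.norm_sub_le_of_not_visited hQ hB (t := τ) (by linarith)
        (norm_anglePt θ) hv h1).trans (by linarith)
  have := two_pi_le_of_univ_subset hcover (hS₁.volume_visited_le _) (hQ.volume_visited_le _)
    (volume_anglePt_near_circle_le hτ hψ0)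
  rw [max_eq_left (by linarith : 0 ≤ τ - 1), max_eq_left (by linarith : 0 ≤ 4 * ψ)] at this
  rcases max_cases (τ - r - 1) 0 with ⟨h, _⟩ | ⟨h, _⟩ <;> rw [h] at this <;> linarith
end
end
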